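/- The holomorph Hol(F₂) of the free group F₂ of rank 2 admits a faithful finite-dimensional linear representation over a field of characteristic zero; that is, there exist a positive integer m and an injective group homomorphism Hol(F₂) → GL_m(ℂ). -/

import Mathlib

open scoped MatrixGroups

namespace LawrenceKrammer

/-- The Lawrence–Krammer matrices of the standard generators of the braid group on four strands
at `q = 1/2` and `t = 8u`, multiplied by two. -/
def gen {R : Type*} [CommRing R] (u : R) : Fin 3 → Matrix (Fin 6) (Fin 6) R := ![
  !![4*u, -4*u, -4*u, 0, 0, 0; 0, 0, 0, 2, 0, 0; 0, 0, 0, 0, 2, 0;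
     0, 1, 0, 1, 0, 0; 0, 0, 1, 0, 1, 0; 0, 0, 0, 0, 0, 2],
  !![1, 2, 0, 0, 0, 0; 1, 0, 0, 0, 0, 0; 0, 0, 2, 0, 0, 0;
     0, -2*u, 2*u, 4*u, -4*u, 0; 0, 0, 0, 0, 0, 2; 0, 0, 0, 0, 1, 1],
  !![2, 0, 0, 0, 0, 0; 0, 1, 2, 0, 0, 0; 0, 1, 0, 0, 0, 0;
     0, 0, 0, 1, 2, 0; 0, 0, 0, 1, 0, 0; 0, 0, -u, 0, -2*u, 4*u]]

/-- The inverses of the matrices `gen u`, where `v` is the inverse of `u`. -/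
noncomputable def genInv (v : ℂ) : Fin 3 → Matrix (Fin 6) (Fin 6) ℂ := ![
  !![v/4, -1/2, -1/2, 1, 1, 0; 0, -1/2, 0, 1, 0, 0; 0, 0, -1/2, 0, 1, 0;
     0, 1/2, 0, 0, 0, 0; 0, 0, 1/2, 0, 0, 0; 0, 0, 0, 0, 0, 1/2],
  !![0, 1, 0, 0, 0, 0; 1/2, -1/2, 0, 0, 0, 0; 0, 0, 1/2, 0, 0, 0;
     1/4, -1/4, -1/4, v/4, -1/2, 1; 0, 0, 0, 0, -1/2, 1; 0, 0, 0, 0, 1/2, 0],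
  !![1/2, 0, 0, 0, 0, 0; 0, 0, 1, 0, 0, 0; 0, 1/2, -1/2, 0, 0, 0;
     0, 0, 0, 0, 1, 0; 0, 0, 0, 1/2, -1/2, 0; 0, 1/8, -1/8, 1/4, -1/4, v/4]]

theorem gen_mul_genInv {u : ℂ} (hu : u ≠ 0) (k : Fin 3) : gen u k * genInv u⁻¹ k = 1 := by
  have h : u * u⁻¹ = 1 := mul_inv_cancel₀ hu
  ext i j
  fin_cases k <;> fin_cases i <;> fin_cases j <;>
    simp [gen, genInv, Matrix.mul_apply, Fin.sum_univ_succ] <;>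
    first | done | linear_combination h | ring

section
variable {R : Type*} [CommRing R] (u : R)

set_option maxHeartbeats 800000 in
theorem gen_braid₀₁ : gen u 0 * gen u 1 * gen u 0 = gen u 1 * gen u 0 * gen u 1 := by
  ext i j
  fin_cases i <;> fin_cases j <;> simp [gen, Matrix.mul_apply, Fin.sum_univ_succ] <;> ring

set_option maxHeartbeats 800000 in
theorem gen_braid₁₂ : gen u 1 * gen u 2 * gen u 1 = gen u 2 * gen u 1 * gen u 2 := by
  ext i j
  fin_cases i <;> fin_cases j <;> simp [gen, Matrix.mul_apply, Fin.sum_univ_succ] <;> ring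

theorem gen_comm₀₂ : gen u 0 * gen u 2 = gen u 2 * gen u 0 := by
  ext i j
  fin_cases i <;> fin_cases j <;> simp [gen, Matrix.mul_apply, Fin.sum_univ_succ] <;> ring

theorem map_gen {S : Type*} [CommRing S] (f : R →+* S) (k : Fin 3) :
    (gen u k).map f = gen (f u) k := by
  have h2 : f 2 = 2 := map_ofNat f 2
  have h4 : f 4 = 4 := map_ofNat f 4
  ext i j
  fin_cases k <;> fin_cases i <;> fin_cases j <;> simp [gen, h2, h4]
end

/-- Three elements of a group satisfying the relations of the braid group on four strands. -/
structure IsBraidTriple {G : Type*} [Group G] (s : Fin 3 → G) : Prop where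
  braid₀₁ : s 0 * s 1 * s 0 = s 1 * s 0 * s 1
  braid₁₂ : s 1 * s 2 * s 1 = s 2 * s 1 * s 2
  comm₀₂ : s 0 * s 2 = s 2 * s 0

/-- Apply a braid relation at the beginning of a word, if there is one that applies. -/
def braidMoveHead : List (Fin 3) → List (Fin 3)
  | i :: j :: l =>
    if (i = 0 ∧ j = 2) ∨ (i = 2 ∧ j = 0) then j :: i :: l
    else match l with
      | k :: l' =>
        if k = i ∧ ((i : ℕ) + 1 = j ∨ (j : ℕ) + 1 = i) then j :: i :: j :: l' else i :: j :: k :: l'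
      | [] => [i, j]
  | l => l

/-- Apply braid relations at the given successive positions. -/
def braidMoves (ps : List ℕ) (l : List (Fin 3)) : List (Fin 3) :=
  ps.foldl (fun l p ↦ l.take p ++ braidMoveHead (l.drop p)) l

namespace IsBraidTriple
variable {G : Type*} [Group G] {s : Fin 3 → G}

theorem prod_braidMoveHead (hs : IsBraidTriple s) (l : List (Fin 3)) :
    ((braidMoveHead l).map s).prod = (l.map s).prod := by
  match l with
  | [] => rfl
  | [i] => rfl
  | [i, j] =>
    have := hs.comm₀₂
    fin_cases i <;> fin_cases j <;> simp [braidMoveHead, this]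
  | i :: j :: k :: l =>
    have h := hs.comm₀₂
    fin_cases i <;> fin_cases j <;> fin_cases k <;>
      simp [braidMoveHead, ← mul_assoc, h, hs.braid₀₁, hs.braid₁₂] <;> simp [mul_assoc, h]

theorem prod_braidMoves (hs : IsBraidTriple s) (ps : List ℕ) (l : List (Fin 3)) :
    ((braidMoves ps l).map s).prod = (l.map s).prod := by
  induction ps generalizing l with
  | nil => rfl
  | cons p ps ih =>
    rw [braidMoves, List.foldl_cons, ← braidMoves, ih, List.map_append, List.prod_append,
      hs.prod_braidMoveHead, ← List.prod_append, ← List.map_append, List.take_append_drop]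

theorem prod_eq_of_braidMoves (hs : IsBraidTriple s) {ps : List ℕ} {l l' : List (Fin 3)}
    (h : l' <+: braidMoves ps l) :
    ∃ r : List (Fin 3), (l.map s).prod = (l'.map s).prod * (r.map s).prod := by
  obtain ⟨r, hr⟩ := h
  exact ⟨r, by rw [← hs.prod_braidMoves ps l, ← hr, List.map_append, List.prod_append]⟩

/-- The square of the Garside element is central, and its product with the inverse of a generator
is a positive word. -/
theorem exists_prod_mul_inv (hs : IsBraidTriple s) (i : Fin 3) : ∃ l : List (Fin 3),
    (([0, 1, 2, 0, 1, 0].map s).prod ^ 2) * (s i)⁻¹ = (l.map s).prod := by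
  have h : ∀ i : Fin 3, ∃ ps, ∃ l : List (Fin 3),
      braidMoves ps [0, 1, 2, 0, 1, 0] = l ++ [i] := by
    intro i
    fin_cases i
    · exact ⟨[], [0, 1, 2, 0, 1], rfl⟩
    · exact ⟨[3], [0, 1, 2, 1, 0], rfl⟩
    · exact ⟨[2, 0, 2, 4], [1, 0, 2, 1, 0], rfl⟩
  obtain ⟨ps, l, hl⟩ := h i
  refine ⟨[0, 1, 2, 0, 1, 0] ++ l, ?_⟩
  have := hs.prod_braidMoves ps [0, 1, 2, 0, 1, 0]
  rw [hl, List.map_append, List.prod_append, List.map_singleton, List.prod_singleton] at this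
  rw [pow_two, List.map_append, List.prod_append, mul_assoc, mul_inv_eq_of_eq_mul this.symm]

theorem commute_garside_sq (hs : IsBraidTriple s) (i : Fin 3) :
    Commute (([0, 1, 2, 0, 1, 0].map s).prod ^ 2) (s i) := by
  have h : ∀ i : Fin 3, ([0, 1, 2, 0, 1, 0].map s).prod * s i =
      s (2 - i) * ([0, 1, 2, 0, 1, 0].map s).prod := by
    have h : ∀ i : Fin 3, ∃ ps,
        braidMoves ps ([0, 1, 2, 0, 1, 0] ++ [i]) = (2 - i) :: [0, 1, 2, 0, 1, 0] := by
      intro i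
      fin_cases i
      · exact ⟨[3, 1, 0], rfl⟩
      · exact ⟨[2, 0, 4], rfl⟩
      · exact ⟨[2, 5, 3, 1, 3], rfl⟩
    intro i
    obtain ⟨ps, hp⟩ := h i
    have := hs.prod_braidMoves ps ([0, 1, 2, 0, 1, 0] ++ [i])
    rw [hp, List.map_append, List.prod_append] at this
    simpa using this.symm
  rw [Commute, SemiconjBy, pow_two, mul_assoc, h, ← mul_assoc, h, mul_assoc, sub_sub_cancel]

theorem exists_pow_mul_eq_prod (hs : IsBraidTriple s) {x : G}
    (hx : x ∈ Subgroup.closure (Set.range s)) :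
    ∃ (n : ℕ) (l : List (Fin 3)),
      (([0, 1, 2, 0, 1, 0].map s).prod ^ 2) ^ n * x = (l.map s).prod := by
  rw [← Subgroup.mem_toSubmonoid, Subgroup.closure_toSubmonoid] at hx
  obtain ⟨L, hL, rfl⟩ := Submonoid.exists_list_of_mem_closure hx
  clear hx
  set z := ([0, 1, 2, 0, 1, 0].map s).prod ^ 2 with hz
  induction L with
  | nil => exact ⟨0, [], by simp⟩
  | cons y L ih =>
    obtain ⟨n, l, hl⟩ := ih fun x hx ↦ hL x (List.mem_cons_of_mem _ hx)
    rcases hL y List.mem_cons_self with ⟨i, rfl⟩ | ⟨i, hi⟩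
    · refine ⟨n, i :: l, ?_⟩
      rw [List.prod_cons, ← mul_assoc, ((hs.commute_garside_sq i).pow_left n).eq, mul_assoc, hl,
        List.map_cons, List.prod_cons]
    · obtain rfl : y = (s i)⁻¹ := by rw [hi, inv_inv]
      obtain ⟨l', hl'⟩ := hs.exists_prod_mul_inv i
      refine ⟨n + 1, l' ++ l, ?_⟩
      rw [List.prod_cons, List.map_append, List.prod_append, ← hl', ← hl, pow_succ', ← hz,
        mul_assoc, mul_assoc, ← mul_assoc (z ^ n), ← mul_assoc _ (z ^ n),
        ((hs.commute_garside_sq i).inv_right.pow_left n).eq]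

end IsBraidTriple

/-- The indices of the nonzero coordinates of a vector in a given state. -/
def supp : Fin 25 → List (Fin 6) := ![
  [0, 1, 2, 3, 4, 5], [1, 2, 3, 4, 5], [0, 1, 2, 4, 5], [0, 1, 2, 3, 4], [0, 2, 4, 5],
  [1, 2, 3, 4], [2, 3, 4, 5], [0, 1, 2, 3], [0, 1, 2, 5], [2, 4, 5], [0, 1, 3], [0, 2, 5],
  [1, 3, 4], [0, 1, 2], [3, 4, 5], [1, 3], [0, 1], [4, 5], [0, 5], [3, 4], [0], [3], [5],
  [0, 1, 4, 5], []]

/-- A positive word which is a left divisor of every braid leading to a given state. -/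
def word : Fin 25 → List (Fin 3) := ![
  [], [0], [1], [2], [1, 0], [2, 0], [0, 1], [2, 1], [1, 2], [0, 1, 0], [2, 1, 0], [1, 2, 0],
  [2, 0, 1], [1, 2, 1], [0, 1, 2], [2, 0, 1, 0], [1, 2, 1, 0], [0, 1, 2, 0], [1, 2, 0, 1],
  [0, 1, 2, 1], [1, 2, 0, 1, 0], [0, 1, 2, 1, 0], [0, 1, 2, 0, 1], [1], [0, 1, 2, 0, 1, 0]]

/-- The state reached from a given state by multiplication by a generator. -/
def next : Fin 25 → Fin 3 → Fin 25 := ![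
  ![1, 2, 3], ![1, 4, 5], ![6, 2, 7], ![5, 8, 3], ![9, 2, 10], ![5, 11, 5], ![1, 9, 12],
  ![12, 13, 3], ![14, 2, 13], ![9, 9, 15], ![15, 16, 3], ![17, 2, 16], ![5, 18, 5], ![19, 13, 13],
  ![1, 17, 19], ![15, 20, 5], ![21, 16, 13], ![9, 17, 21], ![22, 23, 20], ![5, 22, 19],
  ![24, 16, 20], ![15, 24, 19], ![22, 17, 24], ![6, 23, 7], ![24, 24, 24]]

/-- Braid moves which turn `k :: word n` into a word that begins with `word (next n k)`. -/
def transition : Fin 25 → Fin 3 → List ℕ := ![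
  ![[], [], []], ![[], [], []], ![[], [], []], ![[0], [], []], ![[], [], []], ![[0], [], [1]],
  ![[], [0], []], ![[0], [], []], ![[], [], [0]], ![[1], [0], []], ![[0], [], []], ![[], [], [0]],
  ![[0], [], [1]], ![[], [1], [0]], ![[], [0, 2], [0, 1]], ![[0, 2], [], [1]], ![[], [1, 3], [0]],
  ![[3, 1], [0, 2], [0, 1]], ![[], [], [0, 2]], ![[2, 1, 0], [0, 2], [0, 1]],
  ![[], [3, 1, 3], [0, 2]], ![[2, 1, 0, 4, 2], [0, 2], [0, 1]],
  ![[3, 1, 3, 2], [0, 2], [0, 1, 3]], ![[], [], []], ![[3, 1, 3, 2, 5], [0, 2, 4], [0, 1, 3]]]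

/-- Braid moves which turn `word n` into a word that begins with `k`, provided that the `k`-th
simple coordinate vanishes in the state `n`. -/
def descent : Fin 25 → Fin 3 → List ℕ := ![
  ![[], [], []], ![[], [], []], ![[], [], []], ![[], [], []], ![[], [], []], ![[0], [], []],
  ![[], [], []], ![[], [], []], ![[], [], []], ![[], [0], []], ![[], [], []], ![[], [], []],
  ![[0], [], []], ![[], [], [0]], ![[], [], []], ![[0], [], []], ![[], [], [0]],
  ![[], [2, 0], []], ![[], [], []], ![[], [], [1, 0]], ![[], [], [2, 0]], ![[], [], [1, 0]],
  ![[], [2, 0], []], ![[], [], []], ![[], [2, 0], [3, 1, 0]]]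

open scoped Matrix

/-- The vector `v` is nonnegative, with the pattern of zeros prescribed by the state `n`. -/
def IsInState (n : Fin 25) (v : Fin 6 → ℤ) : Prop :=
  ∀ i, 0 ≤ v i ∧ (0 < v i ↔ i ∈ supp n)

/-- The entries of the generators at `u = 0`. -/
def genZero (k : Fin 3) (i j : Fin 6) : ℤ := gen 0 k i j

set_option maxRecDepth 100000 in
theorem IsInState.gen_mulVec {n : Fin 25} {v : Fin 6 → ℤ} (h : IsInState n v) (k : Fin 3) :
    IsInState (next n k) (gen 0 k *ᵥ v) := by
  have h0 : ∀ k i j, 0 ≤ genZero k i j := by decide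
  have h1 : ∀ k i n, i ∈ supp (next n k) ↔ ∃ j, 0 < genZero k i j ∧ j ∈ supp n := by decide
  intro i
  have h2 : ∀ j ∈ Finset.univ, 0 ≤ gen 0 k i j * v j := fun j _ ↦ mul_nonneg (h0 k i j) (h j).1
  refine ⟨Finset.sum_nonneg h2, ?_⟩
  rw [h1, Matrix.mulVec, dotProduct, Finset.sum_pos_iff_of_nonneg h2]
  refine exists_congr fun j ↦ ?_
  rw [← (h j).2]
  constructor
  · rintro ⟨-, hj⟩
    exact ⟨pos_of_mul_pos_left hj (h j).1, pos_of_mul_pos_right hj (h0 k i j)⟩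
  · rintro ⟨hj, hj'⟩
    exact ⟨Finset.mem_univ _, mul_pos hj hj'⟩

/-- The positions of the pairs of consecutive strands. -/
def simpleIndex : Fin 3 → Fin 6 := ![0, 3, 5]

section
variable {G : Type*} [Group G] {s : Fin 3 → G}

theorem exists_isInState (hs : IsBraidTriple s) (l : List (Fin 3)) : ∃ n,
    IsInState n ((l.map (gen 0)).prod *ᵥ 1) ∧
    ∃ r : List (Fin 3), (l.map s).prod = ((word n).map s).prod * (r.map s).prod := by
  induction l with
  | nil =>
    refine ⟨0, fun i ↦ ?_, [], by simp [word]⟩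
    fin_cases i <;> simp [supp]
  | cons k l ih =>
    obtain ⟨n, hn, r, hr⟩ := ih
    have h : ∀ n k, word (next n k) <+: braidMoves (transition n k) (k :: word n) := by decide
    obtain ⟨r', hr'⟩ := hs.prod_eq_of_braidMoves (h n k)
    refine ⟨next n k, ?_, r' ++ r, ?_⟩
    · rw [List.map_cons, List.prod_cons, ← Matrix.mulVec_mulVec]
      exact hn.gen_mulVec k
    · rw [List.map_cons, List.prod_cons] at hr' ⊢
      rw [hr, ← mul_assoc, hr', List.map_append, List.prod_append, mul_assoc]

theorem exists_eq_mul_prod (hs : IsBraidTriple s) {l : List (Fin 3)} {k : Fin 3}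
    (h : ((l.map (gen (0 : ℤ))).prod *ᵥ 1) (simpleIndex k) = 0) :
    ∃ r : List (Fin 3), (l.map s).prod = s k * (r.map s).prod := by
  have h' : ∀ n k, simpleIndex k ∉ supp n → [k] <+: braidMoves (descent n k) (word n) := by decide
  obtain ⟨n, hn, r, hr⟩ := exists_isInState hs l
  have hk : simpleIndex k ∉ supp n := by
    rw [← (hn _).2, h]
    exact lt_irrefl 0
  obtain ⟨r', hr'⟩ := hs.prod_eq_of_braidMoves (h' n k hk)
  exact ⟨r' ++ r, by rw [hr, hr', List.map_append, List.prod_append, List.map_singleton,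
    List.prod_singleton, mul_assoc]⟩
end

theorem prod_cons_mulVec_simpleIndex (k : Fin 3) (l : List (Fin 3)) :
    (((k :: l).map (gen (0 : ℤ))).prod *ᵥ 1) (simpleIndex k) = 0 := by
  rw [List.map_cons, List.prod_cons, ← Matrix.mulVec_mulVec, Matrix.mulVec]
  have h : ∀ k, gen (0 : ℤ) k (simpleIndex k) = 0 := by
    intro k
    ext j
    revert k j
    decide
  rw [h, zero_dotProduct]

theorem prod_gen_zero_eq {u : ℂ} (hu : Transcendental ℤ u) {l l' : List (Fin 3)}
    (h : (l.map (gen u)).prod = (l'.map (gen u)).prod) :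
    (l.map (gen (0 : ℤ))).prod = (l'.map (gen (0 : ℤ))).prod := by
  have key {S : Type} [CommRing S] (f : Polynomial ℤ →+* S) (l : List (Fin 3)) :
      (l.map (gen (f .X))).prod = f.mapMatrix (l.map (gen .X)).prod := by
    rw [map_list_prod, List.map_map]
    congr 2
    ext1 k
    exact (map_gen _ f k).symm
  have h1 := key (Polynomial.aeval u).toRingHom
  have h2 := key (Polynomial.evalRingHom 0)
  simp only [AlgHom.toRingHom_eq_coe, RingHom.coe_coe, Polynomial.aeval_X,
    Polynomial.coe_evalRingHom, Polynomial.eval_X] at h1 h2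
  rw [h1, h1] at h
  rw [h2, h2, Matrix.map_injective (transcendental_iff_injective.mp hu) h]

/-- Positive words with the same image under the representation `gen u` are equal in
every group generated by a braid triple mapping to `gen u`. -/
theorem prod_eq_of_prod_gen_eq {G : Type*} [Group G] {s : Fin 3 → G} (hs : IsBraidTriple s)
    {u : ℂ} (hu : Transcendental ℤ u) (f : G →* Matrix (Fin 6) (Fin 6) ℂ)
    (hf : ∀ k, f (s k) = gen u k) {l l' : List (Fin 3)}
    (h : f (l.map s).prod = f (l'.map s).prod) : (l.map s).prod = (l'.map s).prod := by
  have key : ∀ l l' : List (Fin 3), f (l.map s).prod = f (l'.map s).prod →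
      (l.map (gen (0 : ℤ))).prod = (l'.map (gen (0 : ℤ))).prod := by
    intro l l' h
    apply prod_gen_zero_eq hu
    have : f ∘ s = gen u := funext hf
    simpa only [map_list_prod, List.map_map, this] using h
  induction l generalizing l' with
  | nil =>
    cases l' with
    | nil => rfl
    | cons k l' =>
      have := prod_cons_mulVec_simpleIndex k l'
      rw [← key _ _ h] at this
      simp at this
  | cons k l ih =>
    have := prod_cons_mulVec_simpleIndex k l
    rw [key _ _ h] at this
    obtain ⟨r, hr⟩ := exists_eq_mul_prod hs this
    rw [hr, List.map_cons, List.prod_cons] at h ⊢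
    rw [ih]
    rw [map_mul, map_mul] at h
    simpa [← mul_assoc, ← map_mul] using congr_arg (f (s k)⁻¹ * ·) h

/-- An element in the kernel of the Lawrence–Krammer representation is trivial. -/
theorem eq_one_of_mem_closure {G : Type*} [Group G] {s : Fin 3 → G} (hs : IsBraidTriple s)
    {u : ℂ} (hu : Transcendental ℤ u) (f : G →* Matrix (Fin 6) (Fin 6) ℂ)
    (hf : ∀ k, f (s k) = gen u k) {x : G} (hx : x ∈ Subgroup.closure (Set.range s))
    (h : f x = 1) : x = 1 := by
  obtain ⟨n, l, hl⟩ := hs.exists_pow_mul_eq_prod hx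
  obtain ⟨m, hm⟩ : ∃ m : List (Fin 3),
      (([0, 1, 2, 0, 1, 0].map s).prod ^ 2) ^ n = (m.map s).prod := by
    clear hl
    induction n with
    | zero => exact ⟨[], pow_zero _⟩
    | succ n ih =>
      obtain ⟨m, hm⟩ := ih
      exact ⟨m ++ ([0, 1, 2, 0, 1, 0] ++ [0, 1, 2, 0, 1, 0]), by
        rw [pow_succ, hm, pow_two, List.map_append, List.prod_append, List.map_append,
          List.prod_append]⟩
  rw [hm] at hl
  have := congr_arg f hl
  rw [map_mul, h, mul_one] at this
  rwa [← prod_eq_of_prod_gen_eq hs hu f hf this, mul_eq_left] at hl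

end LawrenceKrammer

namespace FreeGroup
variable {α : Type*}

theorem IsReduced.tail {x : α × Bool} {L : List (α × Bool)} (h : IsReduced (x :: L)) :
    IsReduced L :=
  h.infix (List.suffix_cons x L).isInfix

variable [DecidableEq α]

/-- The length of the longest common prefix of two lists. -/
def lcp {β : Type*} [DecidableEq β] : List β → List β → ℕ
  | x :: l, y :: l' => if x = y then lcp l l' + 1 else 0
  | _, _ => 0

theorem lcp_comm {β : Type*} [DecidableEq β] (l l' : List β) : lcp l l' = lcp l' l := by
  induction l generalizing l' with
  | nil => cases l' <;> rfl
  | cons x l ih =>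
    cases l' with
    | nil => rfl
    | cons y l' =>
      simp only [lcp, ih l']
      split_ifs <;> simp_all

theorem lcp_le {β : Type*} [DecidableEq β] (l l' : List β) : lcp l l' ≤ l.length := by
  induction l generalizing l' with
  | nil => cases l' <;> simp [lcp]
  | cons x l ih =>
    cases l' with
    | nil => simp [lcp]
    | cons y l' =>
      have := ih l'
      simp only [lcp, List.length_cons]
      split_ifs <;> omega

theorem min_lcp_le {β : Type*} [DecidableEq β] (l₁ l₂ l₃ : List β) :
    min (lcp l₁ l₂) (lcp l₂ l₃) ≤ lcp l₁ l₃ := by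
  induction l₁ generalizing l₂ l₃ with
  | nil => simp [lcp]
  | cons x l₁ ih =>
    cases l₂ with
    | nil => simp [lcp]
    | cons y l₂ =>
      cases l₃ with
      | nil => simp [lcp]
      | cons z l₃ =>
        have := ih l₂ l₃
        simp only [lcp]
        split_ifs <;> first | omega | simp_all

theorem IsReduced.norm_mk {L : List (α × Bool)} (h : IsReduced L) : (mk L).norm = L.length := by
  rw [norm, toWord_mk, h.reduce_eq]

theorem norm_mk_inv_mul_mk {L L' : List (α × Bool)} (h : IsReduced L) (h' : IsReduced L') :
    ((mk L)⁻¹ * mk L').norm + 2 * lcp L L' = L.length + L'.length := by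
  induction L generalizing L' with
  | nil => simp [lcp, ← one_eq_mk, h'.norm_mk]
  | cons x L ih =>
    cases L' with
    | nil => rw [← one_eq_mk, mul_one, norm_inv_eq, h.norm_mk]; simp [lcp]
    | cons y L' =>
      by_cases hxy : x = y
      · subst hxy
        have h1 : ∀ l, mk (x :: l) = mk [x] * mk l := fun l ↦ by simp [mul_mk]
        have := ih h.tail h'.tail
        rw [h1 L, h1 L', mul_inv_rev, mul_assoc, inv_mul_cancel_left, lcp, if_pos rfl]
        simp only [List.length_cons]
        omega
      · have h1 : IsReduced (invRev (x :: L)) := by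
          rw [isReduced_iff_reduce_eq, reduce_invRev, h.reduce_eq]
        have h2 : IsReduced (invRev (x :: L) ++ y :: L') := by
          refine List.isChain_append.mpr ⟨h1, h', ?_⟩
          rintro a ha b hb hab
          simp only [invRev, List.map_cons, List.reverse_cons, List.getLast?_append,
            List.getLast?_singleton, Option.some_or, Option.mem_some_iff] at ha
          simp only [List.head?_cons, Option.mem_some_iff] at hb
          subst ha hb
          rcases x with ⟨x, c⟩
          rcases y with ⟨y, d⟩
          cases c <;> cases d <;> simp_all
        rw [inv_mk, mul_mk, h2.norm_mk, lcp, if_neg hxy, List.length_append, invRev_length]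
        simp

/-- The length of the longest common prefix of two elements of a free group. -/
def commonPrefix (x y : FreeGroup α) : ℕ := lcp x.toWord y.toWord

theorem commonPrefix_comm (x y : FreeGroup α) : commonPrefix x y = commonPrefix y x :=
  lcp_comm _ _

theorem commonPrefix_le_left (x y : FreeGroup α) : commonPrefix x y ≤ x.norm :=
  lcp_le _ _

theorem commonPrefix_le_right (x y : FreeGroup α) : commonPrefix x y ≤ y.norm :=
  commonPrefix_comm y x ▸ lcp_le _ _

theorem min_commonPrefix_le (x y z : FreeGroup α) :
    min (commonPrefix x y) (commonPrefix y z) ≤ commonPrefix x z :=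
  min_lcp_le _ _ _

theorem norm_inv_mul_add (x y : FreeGroup α) :
    (x⁻¹ * y).norm + 2 * commonPrefix x y = x.norm + y.norm := by
  have := norm_mk_inv_mul_mk (isReduced_toWord (x := x)) (isReduced_toWord (x := y))
  rwa [mk_toWord, mk_toWord] at this

theorem two_mul_commonPrefix_inv_lt {x : FreeGroup α} (hx : x ≠ 1) :
    2 * commonPrefix x x⁻¹ < x.norm := by
  have h1 := norm_inv_mul_add x⁻¹ x
  rw [inv_inv, norm_inv_eq, commonPrefix_comm] at h1
  have h2 : (x * x).norm =
      x.norm + (reduceCyclically x.toWord).length := by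
    have h := reduceCyclically.reduce_flatten_replicate_succ (isReduced_toWord (x := x)) 1
    have h3 := congr_arg List.length
      (reduceCyclically.conj_conjugator_reduceCyclically x.toWord)
    simp only [List.replicate_succ, List.replicate_zero, List.flatten_cons, List.flatten_nil,
      List.append_nil, ← toWord_mul] at h
    rw [norm, h, norm]
    simp only [List.length_append] at h3 ⊢
    omega
  have h4 : (reduceCyclically x.toWord).length ≠ 0 := by
    intro h
    have h3 := reduceCyclically.conj_conjugator_reduceCyclically x.toWord
    rw [List.eq_nil_of_length_eq_zero h, List.append_nil] at h3
    apply hx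
    rw [← mk_toWord (x := x), ← h3, ← mul_mk, ← inv_mk, mul_inv_cancel]
  omega

theorem exists_commonPrefix_eq_one {x : FreeGroup α} (hx : x ≠ 1) :
    ∃ i, commonPrefix (of i) x = 1 ∨ commonPrefix (of i)⁻¹ x = 1 := by
  rw [Ne, ← toWord_eq_nil_iff] at hx
  obtain ⟨⟨i, c⟩, l, h⟩ := List.exists_cons_of_ne_nil hx
  refine ⟨i, ?_⟩
  cases c
  · right
    simp [commonPrefix, h, toWord_inv, invRev, lcp]
  · left
    simp [commonPrefix, h, lcp]


/-- The free group of rank two. -/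
abbrev F₂ := FreeGroup (Fin 2)

/-- The first generator of `F₂`. -/
abbrev genA : F₂ := of 0

/-- The second generator of `F₂`. -/
abbrev genB : F₂ := of 1

theorem autF₂_ext {φ ψ : MulAut F₂} (hA : φ genA = ψ genA) (hB : φ genB = ψ genB) : φ = ψ := by
  have h : φ.toMonoidHom = ψ.toMonoidHom := by
    ext i
    fin_cases i
    · exact hA
    · exact hB
  exact MulEquiv.toMonoidHom_injective h

/-- The automorphism of `F₂` with given values on the generators. -/
def autF₂ (x y x' y' : F₂) (h : lift ![x', y'] x = genA ∧ lift ![x', y'] y = genB)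
    (h' : lift ![x, y] x' = genA ∧ lift ![x, y] y' = genB) : MulAut F₂ :=
  MonoidHom.toMulEquiv (lift ![x, y]) (lift ![x', y'])
    (by ext i; fin_cases i <;> simpa using by first | exact h.1 | exact h.2)
    (by ext i; fin_cases i <;> simpa using by first | exact h'.1 | exact h'.2)

theorem autF₂_genA {x y x' y' : F₂} (h h') : autF₂ x y x' y' h h' genA = x := lift_apply_of

theorem autF₂_genB {x y x' y' : F₂} (h h') : autF₂ x y x' y' h h' genB = y := lift_apply_of

/-- Automorphisms of `F₂` satisfying the relations of the braid group on four strands. -/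
def braidAut : Fin 3 → MulAut F₂ := ![
  autF₂ genA (genB * genA⁻¹) genA (genB * genA) (by simp) (by simp),
  autF₂ genB (genB * genA⁻¹ * genB) (genA * genB⁻¹ * genA) genA (by simp) (by simp),
  autF₂ genA (genA⁻¹ * genB) genA (genA * genB) (by simp) (by simp)]

@[simp] theorem braidAut_zero_genA : braidAut 0 genA = genA := by
  simp [braidAut, autF₂_genA]
@[simp] theorem braidAut_zero_genB : braidAut 0 genB = genB * genA⁻¹ := by
  simp [braidAut, autF₂_genB]
@[simp] theorem braidAut_one_genA : braidAut 1 genA = genB := by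
  simp [braidAut, autF₂_genA]
@[simp] theorem braidAut_one_genB : braidAut 1 genB = genB * genA⁻¹ * genB := by
  simp [braidAut, autF₂_genB]
@[simp] theorem braidAut_two_genA : braidAut 2 genA = genA := by
  simp [braidAut, autF₂_genA]
@[simp] theorem braidAut_two_genB : braidAut 2 genB = genA⁻¹ * genB := by
  simp [braidAut, autF₂_genB]

theorem isBraidTriple_braidAut : LawrenceKrammer.IsBraidTriple braidAut where
  braid₀₁ := by apply autF₂_ext <;> simp [mul_assoc]
  braid₁₂ := by apply autF₂_ext <;> simp [mul_assoc]
  comm₀₂ := by apply autF₂_ext <;> simp [mul_assoc]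

/-- The involution which conjugates every `braidAut i` to its inverse. -/
def braidInvolution : MulAut F₂ :=
  autF₂ genA⁻¹ (genA⁻¹ * genB * genA⁻¹) genA⁻¹ (genA⁻¹ * genB * genA⁻¹)
    (by simp [mul_assoc]) (by simp [mul_assoc])

@[simp] theorem braidInvolution_genA : braidInvolution genA = genA⁻¹ := autF₂_genA _ _
@[simp] theorem braidInvolution_genB :
    braidInvolution genB = genA⁻¹ * genB * genA⁻¹ := autF₂_genB _ _

theorem braidInvolution_mul_self : braidInvolution * braidInvolution = 1 := by
  apply autF₂_ext <;> simp [mul_assoc]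

theorem braidInvolution_mul_braidAut (i : Fin 3) :
    braidInvolution * braidAut i = (braidAut i)⁻¹ * braidInvolution := by
  rw [eq_inv_mul_iff_mul_eq]
  fin_cases i <;> apply autF₂_ext <;> simp [mul_assoc]

section
variable {G : Type*} [Group G] {s : Fin 3 → G}

/-- The homomorphism from `F₂` to a quotient of the braid group on four strands. -/
def toBraid (s : Fin 3 → G) : F₂ →* G :=
  lift ![s 0 * (s 2)⁻¹, s 1 * (s 0 * (s 2)⁻¹) * (s 1)⁻¹]

@[simp] theorem toBraid_genA : toBraid s genA = s 0 * (s 2)⁻¹ := lift_apply_of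

@[simp] theorem toBraid_genB : toBraid s genB = s 1 * (s 0 * (s 2)⁻¹) * (s 1)⁻¹ := lift_apply_of

theorem toBraid_mem_closure (x : F₂) : toBraid s x ∈ Subgroup.closure (Set.range s) := by
  have h (i) : s i ∈ Subgroup.closure (Set.range s) := Subgroup.subset_closure ⟨i, rfl⟩
  have h1 : (toBraid s).range ≤ Subgroup.closure (Set.range s) := by
    rw [toBraid, range_lift_eq_closure, Subgroup.closure_le]
    rintro _ ⟨i, rfl⟩
    fin_cases i
    · exact mul_mem (h 0) (inv_mem (h 2))
    · exact mul_mem (mul_mem (h 1) (mul_mem (h 0) (inv_mem (h 2)))) (inv_mem (h 1))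
  exact h1 ⟨x, rfl⟩

theorem toBraid_braidAut (hs : LawrenceKrammer.IsBraidTriple s) (i : Fin 3) (x : F₂) :
    toBraid s (braidAut i x) = s i * toBraid s x * (s i)⁻¹ := by
  suffices (toBraid s).comp (braidAut i).toMonoidHom =
      (MulAut.conj (s i)).toMonoidHom.comp (toBraid s) from DFunLike.congr_fun this x
  have h1 : s 1 * (s 2)⁻¹ * (s 1)⁻¹ = (s 2)⁻¹ * (s 1)⁻¹ * s 2 := by
    rw [← mul_inv_rev, ← div_eq_mul_inv, ← div_eq_mul_inv, eq_comm, inv_mul_eq_iff_eq_mul]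
    simp only [div_eq_mul_inv, ← mul_assoc]
    rw [eq_mul_inv_iff_mul_eq, eq_mul_inv_iff_mul_eq, ← hs.braid₁₂]
  have h2 : (s 0)⁻¹ * s 1 * s 0 = s 1 * s 0 * (s 1)⁻¹ := by
    rw [eq_mul_inv_iff_mul_eq, mul_assoc, mul_assoc, inv_mul_eq_iff_eq_mul, ← mul_assoc,
      ← mul_assoc, hs.braid₀₁]
  have h3 : s 0 * (s 2)⁻¹ = (s 2)⁻¹ * s 0 :=
    ((show Commute (s 0) (s 2) from hs.comm₀₂).inv_right).eq
  have h4 : (s 1)⁻¹ * (s 2)⁻¹ * (s 1)⁻¹ = (s 2)⁻¹ * (s 1)⁻¹ * (s 2)⁻¹ := by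
    simpa [mul_assoc] using congr_arg (·⁻¹) hs.braid₁₂
  have h5 : s 1 * (s 0 * (s 2)⁻¹) * (s 1)⁻¹ * (s 0 * (s 2)⁻¹)⁻¹ =
      s 0 * (s 1 * (s 0 * (s 2)⁻¹) * (s 1)⁻¹) * (s 0)⁻¹ := calc
    _ = s 1 * s 0 * ((s 2)⁻¹ * (s 1)⁻¹ * s 2) * (s 0)⁻¹ := by group
    _ = (s 1 * s 0 * s 1) * (s 2)⁻¹ * (s 1)⁻¹ * (s 0)⁻¹ := by rw [← h1]; group
    _ = _ := by rw [← hs.braid₀₁]; group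
  have h6 : s 1 * (s 0 * (s 2)⁻¹) * (s 1)⁻¹ * (s 0 * (s 2)⁻¹)⁻¹ *
      (s 1 * (s 0 * (s 2)⁻¹) * (s 1)⁻¹) = s 1 * (s 1 * (s 0 * (s 2)⁻¹) * (s 1)⁻¹) * (s 1)⁻¹ := calc
    _ = s 1 * s 0 * ((s 2)⁻¹ * (s 1)⁻¹ * s 2) * ((s 0)⁻¹ * s 1 * s 0) * (s 2)⁻¹ * (s 1)⁻¹ := by
      group
    _ = s 1 * s 0 * s 1 * ((s 2)⁻¹ * s 0) * (s 1)⁻¹ * (s 2)⁻¹ * (s 1)⁻¹ := by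
      rw [← h1, h2]; group
    _ = s 1 * (s 0 * s 1 * s 0) * ((s 2)⁻¹ * (s 1)⁻¹ * (s 2)⁻¹) * (s 1)⁻¹ := by
      rw [← h3]; group
    _ = _ := by rw [hs.braid₀₁, ← h4]; group
  have h7 : (s 0 * (s 2)⁻¹)⁻¹ * (s 1 * (s 0 * (s 2)⁻¹) * (s 1)⁻¹) =
      s 2 * (s 1 * (s 0 * (s 2)⁻¹) * (s 1)⁻¹) * (s 2)⁻¹ := calc
    _ = s 2 * ((s 0)⁻¹ * s 1 * s 0) * (s 2)⁻¹ * (s 1)⁻¹ := by group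
    _ = s 2 * s 1 * s 0 * ((s 1)⁻¹ * (s 2)⁻¹ * (s 1)⁻¹) := by rw [h2]; group
    _ = _ := by rw [h4]; group
  ext j
  fin_cases i <;> fin_cases j
  · simp [h3, mul_assoc]
  · simpa using h5
  · simp
  · simpa using h6
  · simp [h3]
  · simpa using h7
end

/-- The centre of `F₂` is trivial. -/
theorem conj_injective_F₂ : Function.Injective (MulAut.conj : F₂ →* MulAut F₂) := by
  refine (injective_iff_map_eq_one _).mpr fun x hx ↦ ?_
  by_contra h
  have hc (c : F₂) : c * x = x * c := by
    have := DFunLike.congr_fun hx c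
    rw [MulAut.conj_apply, MulAut.one_apply, mul_inv_eq_iff_eq_mul] at this
    exact this.symm
  have h1 (y z : F₂) (hy : y.norm = 1) (hz : z.norm = 1) (h : 1 ≤ commonPrefix y z) : y = z := by
    have := norm_inv_mul_add y z
    rw [← inv_mul_eq_one, ← norm_eq_zero]
    omega
  have h2 (y c : F₂) (hy : y.norm = 1) (hc : c.norm = 1) (hyx : commonPrefix y x = 1)
      (h : c * x = x * c) : y = c ∨ y = c⁻¹ := by
    by_contra! hne
    have hc' : c⁻¹.norm = 1 := by rw [norm_inv_eq, hc]
    have e1 := norm_inv_mul_add c⁻¹ x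
    have e2 := norm_inv_mul_add c (c * x)
    have e3 := norm_inv_mul_add x (x * c)
    rw [inv_inv] at e1
    rw [inv_mul_cancel_left] at e2 e3
    rw [← h] at e3
    have e4 := min_commonPrefix_le y x c⁻¹
    have e5 := min_commonPrefix_le y x (c * x)
    have e6 := min_commonPrefix_le y (c * x) c
    rw [commonPrefix_comm x] at e4
    rw [commonPrefix_comm _ c] at e6
    have e9 := commonPrefix_le_right y x
    have e7 : ¬ 1 ≤ commonPrefix y c⁻¹ := fun h ↦ hne.2 (h1 _ _ hy hc' h)
    have e8 : ¬ 1 ≤ commonPrefix y c := fun h ↦ hne.1 (h1 _ _ hy hc h)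
    omega
  have h3 (y : F₂) (hy : y.norm = 1) (hyx : commonPrefix y x = 1) : False := by
    have hA := h2 y genA hy (norm_of 0) hyx (hc _)
    have hB := h2 y genB hy (norm_of 1) hyx (hc _)
    rcases hA with rfl | rfl <;> rcases hB with hB | hB <;> revert hB <;> decide
  obtain ⟨i, hi | hi⟩ := exists_commonPrefix_eq_one h
  · exact h3 _ (norm_of i) hi
  · exact h3 _ (by rw [norm_inv_eq, norm_of]) hi

theorem conj_mul_eq {φ : MulAut F₂} (x : F₂) :
    φ * MulAut.conj x * φ⁻¹ = MulAut.conj (φ x) := by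
  ext y
  simp

theorem toBraid_braidAut_eq_conj : toBraid braidAut = MulAut.conj := by
  have h : braidAut 0 * (braidAut 2)⁻¹ = MulAut.conj genA := by
    rw [mul_inv_eq_iff_eq_mul]
    apply autF₂_ext <;> simp [mul_assoc]
  ext1 i
  fin_cases i
  · exact h
  · have := conj_mul_eq (φ := braidAut 1) genA
    rw [braidAut_one_genA, ← h] at this
    exact this

/-- The automorphism exchanging the generators of `F₂`. -/
def swapAut : MulAut F₂ := autF₂ genB genA genB genA (by simp) (by simp)

@[simp] theorem swapAut_genA : swapAut genA = genB := autF₂_genA _ _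
@[simp] theorem swapAut_genB : swapAut genB = genA := autF₂_genB _ _

/-- The automorphism inverting the second generator of `F₂`. -/
def invAut : MulAut F₂ := autF₂ genA genB⁻¹ genA genB⁻¹ (by simp) (by simp)

@[simp] theorem invAut_genA : invAut genA = genA := autF₂_genA _ _
@[simp] theorem invAut_genB : invAut genB = genB⁻¹ := autF₂_genB _ _

/-- The automorphism `a ↦ b⁻¹ a`, `b ↦ b` of `F₂`. -/
def transvection : MulAut F₂ :=
  autF₂ (genB⁻¹ * genA) genB (genB * genA) genB (by simp) (by simp)

@[simp] theorem transvection_genA : transvection genA = genB⁻¹ * genA := autF₂_genA _ _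
@[simp] theorem transvection_genB : transvection genB = genB := autF₂_genB _ _

/-- The total length of the images of the two generators. -/
def autLength (φ : MulAut F₂) : ℕ := (φ genA).norm + (φ genB).norm

/-- An automorphism of least total length outside of the subgroup `H`. -/
structure IsShortestOutside (H : Subgroup (MulAut F₂)) (φ : MulAut F₂) : Prop where
  intro ::
  notMem : φ ∉ H
  le : ∀ ψ, ψ ∉ H → autLength φ ≤ autLength ψ

/-- In a reduced product `p * v * z` of elements among `u`, `v` and their inverses, the middle
factor `v` does not cancel completely. -/
def LittleCancellation (u v : F₂) : Prop :=
  ∀ p z, (p = v⁻¹ ∨ p = u ∨ p = u⁻¹) → (z = v ∨ z = u ∨ z = u⁻¹) →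
    commonPrefix p v + commonPrefix v⁻¹ z < v.norm

/-- If `v` cancels on both sides up to its middle, conjugation shortens `v⁻¹ * u` and `v`. -/
theorem norm_conj_add_norm_conj_lt {u v x : F₂} (hx : x.norm = 1) (hxv : commonPrefix x v⁻¹ = 1)
    (h1 : v.norm = 2 * commonPrefix u v) (h2 : v.norm = 2 * commonPrefix u⁻¹ v⁻¹)
    (h3 : v.norm ≤ u.norm) :
    (x⁻¹ * (v⁻¹ * u) * x).norm + (x⁻¹ * v * x).norm < (v⁻¹ * u).norm + v.norm := by
  have e0 := commonPrefix_le_right x v⁻¹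
  have e1 := norm_inv_mul_add v u
  have e2 := norm_inv_mul_add v⁻¹ (v⁻¹ * u)
  have e3 := min_commonPrefix_le x v⁻¹ (v⁻¹ * u)
  have e4 := norm_inv_mul_add x (v⁻¹ * u)
  have e5 := norm_inv_mul_add u⁻¹ (v⁻¹ * u)⁻¹
  have e6 := min_commonPrefix_le x v⁻¹ u⁻¹
  have e7 := min_commonPrefix_le x u⁻¹ (v⁻¹ * u)⁻¹
  have e8 := norm_inv_mul_add (v⁻¹ * u)⁻¹ ((v⁻¹ * u)⁻¹ * x)
  have e9 := min_commonPrefix_le x (v⁻¹ * u)⁻¹ ((v⁻¹ * u)⁻¹ * x)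
  have e10 := norm_inv_mul_add x ((v⁻¹ * u)⁻¹ * x)
  have e11 := norm_inv_mul_add x v⁻¹
  have e12 := norm_mul_le (x⁻¹ * v⁻¹) x
  have e13 := commonPrefix_le_left x (v⁻¹ * u)
  have e14 := commonPrefix_le_left x ((v⁻¹ * u)⁻¹ * x)
  rw [← norm_inv_eq (x := ((v⁻¹ * u)⁻¹ * x))] at e8 e10
  rw [show u⁻¹⁻¹ * (v⁻¹ * u)⁻¹ = v by group] at e5
  rw [← norm_inv_eq (x := x⁻¹ * v * x), ← norm_inv_eq (x := x⁻¹ * (v⁻¹ * u) * x)]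
  rw [show (x⁻¹ * v * x)⁻¹ = x⁻¹ * v⁻¹ * x by group,
    show (x⁻¹ * (v⁻¹ * u) * x)⁻¹ = x⁻¹ * ((v⁻¹ * u)⁻¹ * x) by group]
  rw [commonPrefix_comm v⁻¹ u⁻¹] at e6
  rw [commonPrefix_comm v u] at e1
  rw [show ((v⁻¹ * u)⁻¹ * x)⁻¹ = x⁻¹ * (v⁻¹ * u) by group] at e8 e10
  simp only [inv_inv, mul_inv_cancel_left, norm_inv_eq] at *
  omega

namespace IsShortestOutside
variable {H : Subgroup (MulAut F₂)} {φ : MulAut F₂}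

theorem mul_right (h : IsShortestOutside H φ) {ψ : MulAut F₂} (hψ : ψ ∈ H)
    (hle : autLength (φ * ψ) ≤ autLength φ) : IsShortestOutside H (φ * ψ) where
  notMem h' := h.notMem ((H.mul_mem_cancel_right hψ).mp h')
  le ψ' h' := hle.trans (h.le ψ' h')

theorem mul_swapAut (h : IsShortestOutside H φ) (hs : swapAut ∈ H) :
    IsShortestOutside H (φ * swapAut) :=
  h.mul_right hs (by simp [autLength, add_comm])

theorem mul_invAut (h : IsShortestOutside H φ) (hi : invAut ∈ H) :
    IsShortestOutside H (φ * invAut) :=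
  h.mul_right hi (by simp [autLength])

theorem two_mul_commonPrefix_le (h : IsShortestOutside H φ) (ht : transvection ∈ H) :
    2 * commonPrefix (φ genB) (φ genA) ≤ (φ genB).norm := by
  have h1 := h.le (φ * transvection) fun h' ↦ h.notMem ((H.mul_mem_cancel_right ht).mp h')
  have h2 := norm_inv_mul_add (φ genB) (φ genA)
  simp only [autLength, MulAut.mul_apply, transvection_genA, transvection_genB, _root_.map_mul,
    _root_.map_inv] at h1
  omega

theorem not_half_cancellation (h : IsShortestOutside H φ) (hc : ∀ g, MulAut.conj g ∈ H)
    (hs : swapAut ∈ H) (ht : transvection ∈ H)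
    (h1 : (φ genB).norm = 2 * commonPrefix (φ genA) (φ genB)) :
    (φ genB).norm ≠ 2 * commonPrefix (φ genA)⁻¹ (φ genB)⁻¹ := by
  intro h2
  have h3 : φ genB ≠ 1 := by simp
  have h4 := (h.mul_swapAut hs).two_mul_commonPrefix_le ht
  simp only [MulAut.mul_apply, swapAut_genA, swapAut_genB] at h4
  have h5 : IsShortestOutside H (φ * transvection) := by
    refine h.mul_right ht ?_
    have := norm_inv_mul_add (φ genB) (φ genA)
    rw [commonPrefix_comm] at this
    simp only [autLength, MulAut.mul_apply, transvection_genA, transvection_genB, _root_.map_mul,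
      _root_.map_inv]
    omega
  obtain ⟨x, hx1, hx⟩ : ∃ x : F₂, x.norm = 1 ∧ commonPrefix x (φ genB)⁻¹ = 1 := by
    obtain ⟨i, hi | hi⟩ := exists_commonPrefix_eq_one (inv_ne_one.mpr h3)
    · exact ⟨_, norm_of i, hi⟩
    · exact ⟨_, by rw [norm_inv_eq, norm_of], hi⟩
  have h6 := h5.le (MulAut.conj x⁻¹ * (φ * transvection)) fun h' ↦
    h5.notMem ((H.mul_mem_cancel_left (hc _)).mp h')
  simp only [autLength, MulAut.mul_apply, transvection_genA, transvection_genB,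
    MulAut.conj_apply, inv_inv] at h6
  rw [_root_.map_mul, _root_.map_inv] at h6
  exact h6.not_gt (norm_conj_add_norm_conj_lt hx1 hx h1 h2 (by omega))

theorem littleCancellation (h : IsShortestOutside H φ) (hc : ∀ g, MulAut.conj g ∈ H)
    (hs : swapAut ∈ H) (hi : invAut ∈ H) (ht : transvection ∈ H) :
    LittleCancellation (φ genA) (φ genB) := by
  have hφ := ((h.mul_swapAut hs).mul_invAut hi).mul_swapAut hs
  have c1 := h.two_mul_commonPrefix_le ht
  have c2 := hφ.two_mul_commonPrefix_le ht
  have c3 := (h.mul_invAut hi).two_mul_commonPrefix_le ht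
  have c4 := (hφ.mul_invAut hi).two_mul_commonPrefix_le ht
  have c5 := h.not_half_cancellation hc hs ht
  have c6 := hφ.not_half_cancellation hc hs ht
  have c7 := two_mul_commonPrefix_inv_lt (show φ genB ≠ 1 by simp)
  have c8 := min_commonPrefix_le (φ genB) (φ genA) (φ genB)⁻¹
  have c9 := min_commonPrefix_le (φ genB) (φ genA)⁻¹ (φ genB)⁻¹
  simp only [MulAut.mul_apply, swapAut_genA, swapAut_genB, invAut_genA, invAut_genB,
    _root_.map_inv, norm_inv_eq, inv_inv, commonPrefix_comm (φ genA),
    commonPrefix_comm (φ genA)⁻¹] at c1 c2 c3 c4 c5 c6 c8 c9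
  rintro p z (rfl | rfl | rfl) (rfl | rfl | rfl) <;>
    simp only [commonPrefix_comm (φ genA), commonPrefix_comm (φ genA)⁻¹,
      commonPrefix_comm (φ genB)⁻¹ (φ genB)] <;>
    omega

/-- The image of a letter is not cancelled completely by the images of its neighbours. -/
theorem commonPrefix_add_commonPrefix_lt (h : IsShortestOutside H φ)
    (hc : ∀ g, MulAut.conj g ∈ H) (hs : swapAut ∈ H) (hi : invAut ∈ H) (ht : transvection ∈ H)
    {p c d : Fin 2 × Bool} (hp : p ≠ c) (hd : c.1 = d.1 → c.2 = d.2) :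
    commonPrefix (φ (mk [p])) (φ (mk [c])) + commonPrefix (φ (mk [c]))⁻¹ (φ (mk [d])) <
      (φ (mk [c])).norm := by
  have hA (i : Fin 2) : φ (mk [(i, true)]) = φ (of i) := rfl
  have hB (i : Fin 2) : φ (mk [(i, false)]) = (φ (of i))⁻¹ := _root_.map_inv φ (of i)
  have h1 := h.littleCancellation hc hs hi ht
  have h2 := (h.mul_invAut hi).littleCancellation hc hs hi ht
  have h3 := (h.mul_swapAut hs).littleCancellation hc hs hi ht
  have h4 := ((h.mul_swapAut hs).mul_invAut hi).littleCancellation hc hs hi ht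
  simp only [MulAut.mul_apply, swapAut_genA, swapAut_genB, invAut_genA, invAut_genB,
    _root_.map_inv] at h2 h3 h4
  have h0 (i : Fin 2) : i = 0 ∨ i = 1 := by omega
  obtain ⟨i, c⟩ := c
  obtain ⟨j, p⟩ := p
  obtain ⟨k, d⟩ := d
  rcases h0 i with rfl | rfl <;> cases c
  · simp only [hB]
    apply h4 <;> rcases h0 j with rfl | rfl <;> rcases h0 k with rfl | rfl <;> cases p <;>
      cases d <;> simp_all
  · simp only [hA]
    apply h3 <;> rcases h0 j with rfl | rfl <;> rcases h0 k with rfl | rfl <;> cases p <;>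
      cases d <;> simp_all
  · simp only [hB]
    apply h2 <;> rcases h0 j with rfl | rfl <;> rcases h0 k with rfl | rfl <;> cases p <;>
      cases d <;> simp_all
  · simp only [hA]
    apply h1 <;> rcases h0 j with rfl | rfl <;> rcases h0 k with rfl | rfl <;> cases p <;>
      cases d <;> simp_all

theorem commonPrefix_lt_of_isReduced (h : IsShortestOutside H φ)
    (hc : ∀ g, MulAut.conj g ∈ H) (hs : swapAut ∈ H) (hi : invAut ∈ H) (ht : transvection ∈ H)
    {p c : Fin 2 × Bool} {L : List (Fin 2 × Bool)} (hL : IsReduced (c :: L)) (hp : p ≠ c) :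
    commonPrefix (φ (mk [p])) (φ (mk [c])) < commonPrefix (φ (mk [c])) (φ (mk (c :: L))) ∧
      commonPrefix (φ (mk [p])) (φ (mk [c])) + L.length + 1 ≤ (φ (mk (c :: L))).norm := by
  induction L generalizing p c with
  | nil =>
    have e1 := h.commonPrefix_add_commonPrefix_lt hc hs hi ht hp (d := c) fun _ ↦ rfl
    have e2 := norm_inv_mul_add (φ (mk [c])) (φ (mk [c]))
    rw [inv_mul_cancel, norm_one] at e2
    simp only [List.length_nil]
    omega
  | cons d L ih =>
    rw [isReduced_cons_cons] at hL
    have e1 := h.commonPrefix_add_commonPrefix_lt hc hs hi ht hp hL.1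
    have hd : (c.1, !c.2) ≠ d := by
      rintro rfl
      simp at hL
    obtain ⟨e2, e3⟩ := ih hL.2 hd
    have hy : φ (mk [(c.1, !c.2)]) = (φ (mk [c]))⁻¹ := by
      rw [← _root_.map_inv, inv_mk]
      rfl
    have hg : φ (mk (c :: d :: L)) = φ (mk [c]) * φ (mk (d :: L)) := by
      rw [← _root_.map_mul, mul_mk]
      rfl
    rw [hy] at e2 e3
    rw [hg]
    have e4 := min_commonPrefix_le (φ (mk [c]))⁻¹ (φ (mk (d :: L))) (φ (mk [d]))
    have e5 := norm_inv_mul_add (φ (mk [c]))⁻¹ (φ (mk (d :: L)))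
    have e6 := norm_inv_mul_add (φ (mk [c])) (φ (mk [c]) * φ (mk (d :: L)))
    rw [commonPrefix_comm (φ (mk (d :: L)))] at e4
    rw [inv_inv, norm_inv_eq] at e5
    rw [inv_mul_cancel_left] at e6
    simp only [List.length_cons]
    omega

theorem norm_le (h : IsShortestOutside H φ) (hc : ∀ g, MulAut.conj g ∈ H) (hs : swapAut ∈ H)
    (hi : invAut ∈ H) (ht : transvection ∈ H) (x : F₂) : x.norm ≤ (φ x).norm := by
  rw [norm, ← mk_toWord (x := x), toWord_mk, (isReduced_toWord (x := x)).reduce_eq]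
  have hx := isReduced_toWord (x := x)
  cases hL : x.toWord with
  | nil => simp
  | cons c L =>
    rw [hL] at hx
    have hp : (c.1, !c.2) ≠ c := by simp [Prod.ext_iff]
    have := (h.commonPrefix_lt_of_isReduced hc hs hi ht hx hp).2
    rw [List.length_cons]
    omega

end IsShortestOutside

theorem exists_eq_of_norm_eq_one {α : Type*} [DecidableEq α] {x : FreeGroup α} (hx : x.norm = 1) :
    ∃ i, x = of i ∨ x = (of i)⁻¹ := by
  have h0 : x ≠ 1 := by rintro rfl; simp at hx
  have h1 (y : FreeGroup α) (hy : y.norm = 1) (h : commonPrefix y x = 1) : x = y := by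
    have := norm_inv_mul_add y x
    rw [eq_comm, ← inv_mul_eq_one, ← norm_eq_zero]
    omega
  obtain ⟨i, hi | hi⟩ := exists_commonPrefix_eq_one h0
  · exact ⟨i, .inl (h1 _ (norm_of i) hi)⟩
  · exact ⟨i, .inr (h1 _ (by rw [norm_inv_eq, norm_of]) hi)⟩

theorem mem_of_norm_eq_one {H : Subgroup (MulAut F₂)} (hs : swapAut ∈ H) (hi : invAut ∈ H)
    {ψ : MulAut F₂} (hA : (ψ genA).norm = 1) (hB : (ψ genB).norm = 1) : ψ ∈ H := by
  have h1 (ψ : MulAut F₂) (hA : ψ genA = genA) (hB : (ψ genB).norm = 1) : ψ ∈ H := by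
    obtain ⟨i, h⟩ := exists_eq_of_norm_eq_one hB
    have h' : ψ genB ≠ ψ genA ∧ ψ genB ≠ ψ genA⁻¹ := by
      simp only [ne_eq, EmbeddingLike.apply_eq_iff_eq]
      decide
    rw [_root_.map_inv, hA] at h'
    rcases (by omega : i = 0 ∨ i = 1) with rfl | rfl
    · tauto
    · rcases h with h | h
      · rw [show ψ = 1 from autF₂_ext hA h]
        exact one_mem H
      · rw [show ψ = invAut from autF₂_ext (by simpa using hA) (by simpa using h)]
        exact hi
  have hn (x : F₂) (hx : x.norm = 1) : (swapAut x).norm = 1 ∧ (invAut x).norm = 1 := by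
    obtain ⟨i, h⟩ := exists_eq_of_norm_eq_one hx
    rcases (by omega : i = 0 ∨ i = 1) with rfl | rfl <;> rcases h with rfl | rfl <;> simp
  obtain ⟨i, h⟩ := exists_eq_of_norm_eq_one hA
  rcases (by omega : i = 0 ∨ i = 1) with rfl | rfl <;> rcases h with h | h
  · exact h1 ψ h hB
  · refine (H.mul_mem_cancel_left (mul_mem (mul_mem hs hi) hs)).mp (h1 _ ?_ ?_)
    · simp [h]
    · exact (hn _ (hn _ (hn _ hB).1).2).1
  · refine (H.mul_mem_cancel_left hs).mp (h1 _ ?_ (hn _ hB).1)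
    simp [h]
  · refine (H.mul_mem_cancel_left (mul_mem hs hi)).mp (h1 _ ?_ (hn _ (hn _ hB).2).1)
    simp [h]

theorem eq_top_of_mem {H : Subgroup (MulAut F₂)} (hc : ∀ g, MulAut.conj g ∈ H)
    (hs : swapAut ∈ H) (hi : invAut ∈ H) (ht : transvection ∈ H) : H = ⊤ := by
  by_contra hH
  obtain ⟨ψ, hψ⟩ : ∃ ψ, ψ ∉ H := by
    by_contra! h
    exact hH (eq_top_iff.mpr fun φ _ ↦ h φ)
  let φ := Function.argminOn autLength {ψ | ψ ∉ H} ⟨ψ, hψ⟩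
  have h : IsShortestOutside H φ :=
    ⟨Function.argminOn_mem autLength {ψ | ψ ∉ H} _,
      fun ψ hψ ↦ Function.argminOn_le autLength {ψ | ψ ∉ H} hψ⟩
  refine h.notMem (inv_mem_iff.mp (mem_of_norm_eq_one hs hi ?_ ?_))
  all_goals
    refine le_antisymm ((h.norm_le hc hs hi ht _).trans ?_) ?_
    · rw [MulAut.apply_inv_self, norm_of]
    · rw [Nat.one_le_iff_ne_zero, Ne, norm_eq_zero]
      simp


theorem eq_top_of_braidAut_mem {H : Subgroup (MulAut F₂)} (hc : ∀ g, MulAut.conj g ∈ H)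
    (hb : ∀ i, braidAut i ∈ H) (hτ : braidInvolution ∈ H) : H = ⊤ := by
  have ht : transvection ∈ H := by
    refine (H.mul_mem_cancel_left (mul_mem (hb 1) (hb 0))).mp ?_
    convert hb 0
    apply autF₂_ext <;> simp [mul_assoc]
  have h1 : swapAut * invAut * swapAut ∈ H := by
    refine (H.mul_mem_cancel_left (mul_mem (hb 0) (hb 2))).mp ?_
    convert hτ
    apply autF₂_ext <;> simp [mul_assoc]
  have h2 : swapAut * invAut ∈ H := by
    refine (H.mul_mem_cancel_left (mul_mem (hb 0) (hc genB))).mp ?_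
    have h : braidAut 0 * MulAut.conj genB * (swapAut * invAut) =
        braidAut 1 * braidAut 0 * braidAut 1 * braidAut 0 := by
      apply autF₂_ext <;> simp [mul_assoc]
    exact h ▸ mul_mem (mul_mem (mul_mem (hb 1) (hb 0)) (hb 1)) (hb 0)
  have hs : swapAut ∈ H := (H.mul_mem_cancel_left h2).mp h1
  exact eq_top_of_mem hc hs ((H.mul_mem_cancel_left hs).mp h2) ht

end FreeGroup

section LinearPerms
variable (K : Type*) {X V : Type*} [Field K] [AddCommGroup V] [Module K V]

/-- The permutations of `X` which become linear under the map `s : X → V`. -/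
def linearPerms (s : X → V) : Subgroup (Equiv.Perm X) where
  carrier := {g | ∃ P : V ≃ₗ[K] V, ∀ x, s (g x) = P (s x)}
  one_mem' := ⟨.refl K V, fun _ ↦ rfl⟩
  mul_mem' := by
    rintro g h ⟨P, hP⟩ ⟨Q, hQ⟩
    exact ⟨Q.trans P, fun x ↦ by simp [hP, hQ]⟩
  inv_mem' := by
    rintro g ⟨P, hP⟩
    exact ⟨P.symm, fun x ↦ by
      rw [LinearEquiv.eq_symm_apply, ← hP, ← Equiv.Perm.mul_apply, mul_inv_cancel,
        Equiv.Perm.one_apply]⟩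

variable {K}

/-- The restriction to `X` of the linear functionals on `V`. -/
def dualRestrict (s : X → V) : Module.Dual K V →ₗ[K] X → K :=
  LinearMap.funLeft K K s ∘ₗ LinearMap.ltoFun K V K K

theorem funLeft_mem_range_dualRestrict {s : X → V} {g : Equiv.Perm X} (hg : g ∈ linearPerms K s)
    (f : X → K) (hf : f ∈ (dualRestrict (K := K) s).range) :
    LinearMap.funLeft K K g f ∈ (dualRestrict (K := K) s).range := by
  obtain ⟨P, hP⟩ := hg
  obtain ⟨l, rfl⟩ := hf
  exact ⟨l ∘ₗ P.toLinearMap, funext fun x ↦ congr_arg l (hP x).symm⟩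

/-- The linear representation of `linearPerms K s` on the restrictions of functionals. -/
def linearPermsRep (s : X → V) :
    linearPerms K s →* Module.End K (dualRestrict (K := K) s).range where
  toFun g := (LinearMap.funLeft K K ⇑(g⁻¹ : linearPerms K s).1).restrict
    (funLeft_mem_range_dualRestrict g⁻¹.2)
  map_one' := rfl
  map_mul' g h := by
    ext f x
    simp [LinearMap.funLeft_apply]

theorem linearPermsRep_injective {s : X → V} (hs : Function.Injective s) :
    Function.Injective (linearPermsRep (K := K) s) := by
  refine (injective_iff_map_eq_one _).mpr fun g hg ↦ inv_eq_one.mp (Subtype.ext (Equiv.ext fun x ↦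
    hs (sub_eq_zero.mp ((Module.forall_dual_apply_eq_zero_iff K _).mp fun l ↦ ?_))))
  rw [map_sub, sub_eq_zero]
  have := congr_arg Subtype.val (LinearMap.congr_fun hg ⟨_, l, rfl⟩)
  exact congr_fun this x

theorem exists_injective_hom_GL [FiniteDimensional K V] {s : X → V} (hs : Function.Injective s) :
    ∃ (m : ℕ) (ρ : linearPerms K s →* GL (Fin m) K), Function.Injective ρ := by
  let b := Module.finBasis K (dualRestrict (K := K) s).range
  let e := (LinearMap.toMatrixAlgEquiv b).toAlgHom.toMonoidHom
  refine ⟨_, (e.comp (linearPermsRep s)).toHomUnits, fun g h hgh ↦ linearPermsRep_injective hs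
    ((LinearMap.toMatrixAlgEquiv b).injective ?_)⟩
  exact congr_arg Units.val hgh

end LinearPerms

namespace FreeGroup
open LawrenceKrammer

section
variable {A : Type*} [Ring A] [Algebra ℂ A]

/-- The embedding of `F₂` into a vector space which is equivariant under the holomorph. -/
def braidPair (t : Fin 3 → Aˣ) (x : F₂) : A × A :=
  (toBraid t x, toBraid t (braidInvolution x))

/-- Conjugation by units on the two factors, as a linear map. -/
def conjProd (g h : Aˣ) : (A × A) ≃ₗ[ℂ] A × A :=
  (DistribMulAction.toLinearEquiv ℂ A (ConjAct.toConjAct g)).prodCongr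
    (DistribMulAction.toLinearEquiv ℂ A (ConjAct.toConjAct h))

theorem conjProd_apply (g h : Aˣ) (x y : A) :
    conjProd g h (x, y) = (g * x * ↑g⁻¹, h * y * ↑h⁻¹) := rfl

theorem toPerm_mem_linearPerms {t : Fin 3 → Aˣ} (ht : IsBraidTriple t) (φ : MulAut F₂) :
    MulAut.toPerm F₂ φ ∈ linearPerms ℂ (braidPair t) := by
  suffices (linearPerms ℂ (braidPair t)).comap (MulAut.toPerm F₂) = ⊤ from
    (this ▸ Subgroup.mem_top φ :)
  have hp (ψ : MulAut F₂) (x : F₂) : MulAut.toPerm F₂ ψ x = ψ x := rfl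
  refine eq_top_of_braidAut_mem (fun g ↦ ?_) (fun i ↦ ?_) ?_
  · refine ⟨conjProd (toBraid t g) (toBraid t (braidInvolution g)), fun x ↦ ?_⟩
    simp [braidPair, hp, conjProd_apply]
  · refine ⟨conjProd (t i) (t i)⁻¹, fun x ↦ ?_⟩
    have h1 : braidInvolution (braidAut i x) = (braidAut i)⁻¹ (braidInvolution x) :=
      DFunLike.congr_fun (braidInvolution_mul_braidAut i) x
    have h2 (y : F₂) : toBraid t ((braidAut i)⁻¹ y) = (t i)⁻¹ * toBraid t y * t i := by
      have := toBraid_braidAut ht i ((braidAut i)⁻¹ y)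
      rw [MulAut.apply_inv_self] at this
      rw [this]
      group
    have h3 := h2 (braidInvolution x)
    rw [← h1] at h3
    simp [braidPair, hp, conjProd_apply, h3, toBraid_braidAut ht]
  · refine ⟨LinearEquiv.prodComm ℂ A A, fun x ↦ ?_⟩
    have h1 : braidInvolution (braidInvolution x) = x :=
      DFunLike.congr_fun braidInvolution_mul_self x
    simp [braidPair, hp, h1]

theorem toPermHom_mem_linearPerms (t : Fin 3 → Aˣ) (g : F₂) :
    MulAction.toPermHom F₂ F₂ g ∈ linearPerms ℂ (braidPair t) := by
  refine ⟨(DistribMulAction.toLinearEquiv ℂ A (toBraid t g)).prodCongr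
    (DistribMulAction.toLinearEquiv ℂ A (toBraid t (braidInvolution g))), fun x ↦ ?_⟩
  simp [braidPair, Units.smul_def]
end

/-- The natural action of the holomorph of a group. -/
def holomorphToPerm (G : Type*) [Group G] :
    G ⋊[MonoidHom.id (MulAut G)] MulAut G →* Equiv.Perm G :=
  SemidirectProduct.lift (MulAction.toPermHom G G) (MulAut.toPerm G) fun φ ↦ by
    ext g x
    change φ g * x = φ (g * φ⁻¹ x)
    simp

theorem holomorphToPerm_injective (G : Type*) [Group G] :
    Function.Injective (holomorphToPerm G) := by
  intro g h hgh
  have h1 (x : G) : g.left * g.right x = h.left * h.right x := DFunLike.congr_fun hgh x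
  have h2 : g.left = h.left := by simpa using h1 1
  refine SemidirectProduct.ext h2 (MulEquiv.ext fun x ↦ ?_)
  simpa [h2] using h1 x

theorem toBraid_injective {u : ℂ} (hu : Transcendental ℤ u)
    {t : Fin 3 → (Matrix (Fin 6) (Fin 6) ℂ)ˣ} (ht : IsBraidTriple t) (h : ∀ k, ↑(t k) = gen u k) :
    Function.Injective (toBraid t) := by
  let s (k : Fin 3) := (t k, braidAut k)
  have hs : IsBraidTriple s :=
    ⟨Prod.ext ht.braid₀₁ isBraidTriple_braidAut.braid₀₁,
      Prod.ext ht.braid₁₂ isBraidTriple_braidAut.braid₁₂,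
      Prod.ext ht.comm₀₂ isBraidTriple_braidAut.comm₀₂⟩
  have h1 : (MonoidHom.fst _ _).comp (toBraid s) = toBraid t := by
    ext1 i
    fin_cases i <;> simp [s, toBraid]
  have h2 : (MonoidHom.snd _ _).comp (toBraid s) = toBraid braidAut := by
    ext1 i
    fin_cases i <;> simp [s, toBraid]
  refine (injective_iff_map_eq_one _).mpr fun x hx ↦ ?_
  have h3 : toBraid s x = 1 := by
    refine eq_one_of_mem_closure hs hu ((Units.coeHom _).comp (MonoidHom.fst _ _)) h
      (toBraid_mem_closure x) ?_
    rw [← h1] at hx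
    exact congr_arg Units.val hx
  have h4 : MulAut.conj x = 1 := by
    rw [← toBraid_braidAut_eq_conj, ← h2, MonoidHom.comp_apply, h3, _root_.map_one]
  exact conj_injective_F₂ (h4.trans (_root_.map_one _).symm)

end FreeGroup

namespace LawrenceKrammer

theorem exists_transcendental : ∃ u : ℂ, Transcendental ℤ u :=
  ⟨_, (transcendental_algebraMap_iff (algebraMap ℝ ℂ).injective).mpr
    (transcendental_liouvilleNumber le_rfl)⟩

/-- The images of the generators under the Lawrence-Krammer representation. -/
noncomputable def unitGen {u : ℂ} (hu : u ≠ 0) (k : Fin 3) : (Matrix (Fin 6) (Fin 6) ℂ)ˣ where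
  val := gen u k
  inv := genInv u⁻¹ k
  val_inv := gen_mul_genInv hu k
  inv_val := mul_eq_one_comm.mp (gen_mul_genInv hu k)

theorem isBraidTriple_unitGen {u : ℂ} (hu : u ≠ 0) : IsBraidTriple (unitGen hu) where
  braid₀₁ := Units.ext (gen_braid₀₁ u)
  braid₁₂ := Units.ext (gen_braid₁₂ u)
  comm₀₂ := Units.ext (gen_comm₀₂ u)

end LawrenceKrammer

/-- **Corollary 3.** The holomorph `Hol(F₂)` of the free group `F₂` of rank 2 has a
faithful linear representation over a field of characteristic zero. -/
theorem holomorph_F2_linear :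
    ∃ (m : ℕ) (_ : 0 < m)
      (ρ : (FreeGroup (Fin 2) ⋊[MonoidHom.id (MulAut (FreeGroup (Fin 2)))]
              MulAut (FreeGroup (Fin 2))) →* GL (Fin m) ℂ),
      Function.Injective ρ := by
  obtain ⟨u, hu⟩ := LawrenceKrammer.exists_transcendental
  have h0 : u ≠ 0 := fun h ↦ hu (h ▸ isAlgebraic_zero)
  have ht := LawrenceKrammer.isBraidTriple_unitGen h0
  have hs : Function.Injective (FreeGroup.braidPair (LawrenceKrammer.unitGen h0)) :=
    fun x y h ↦ FreeGroup.toBraid_injective hu ht (fun _ ↦ rfl) (Units.ext (congr_arg Prod.fst h))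
  obtain ⟨m, ρ, hρ⟩ := exists_injective_hom_GL (K := ℂ) hs
  let α := (FreeGroup.holomorphToPerm (FreeGroup (Fin 2))).codRestrict _ fun g ↦
    mul_mem (FreeGroup.toPermHom_mem_linearPerms _ g.left)
      (FreeGroup.toPerm_mem_linearPerms ht g.right)
  have hα : Function.Injective (ρ.comp α) := hρ.comp fun g h hgh ↦
    FreeGroup.holomorphToPerm_injective _ (congr_arg Subtype.val hgh)
  refine ⟨m, Nat.pos_of_ne_zero ?_, _, hα⟩
  rintro rfl
  have h := hα.subsingleton
  exact FreeGroup.of_ne_one (0 : Fin 2)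
    (SemidirectProduct.inl_injective (h.elim _ _))
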